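/- For every degree sequence {k_i} realizable by a loopy graph, the augmented graph of loopy graphs 𝒢_△({k_i}) is connected: any two loopy graphs with degree sequence {k_i} are linked by a finite sequence of moves, each of which is either a valid double edge swap or a valid triangle-loop swap. -/

import Mathlib

open scoped Classical

/-- A loopy graph: at most one edge between any two distinct vertices and at most one
self-loop at each vertex, encoded as a symmetric adjacency relation. -/
structure LoopyGraph (V : Type) where
  Adj : V → V → Prop
  symm : ∀ u v : V, Adj u v → Adj v u

namespace LoopyGraph

variable {V : Type}

/-- The neighbors of `u` (vertices other than `u` adjacent to `u`). -/
def nbr (G : LoopyGraph V) (u : V) : Set V := {v | v ≠ u ∧ G.Adj u v}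

/-- Degree of a vertex: each self-loop contributes `2`. -/
noncomputable def deg (G : LoopyGraph V) (u : V) : ℕ :=
  (G.nbr u).ncard + (if G.Adj u u then 2 else 0)

/-- `G₂` is obtained from `G₁` by a single valid double edge swap
`(u,v),(x,y) ⤳ (u,x),(v,y)`: the two removed edges are distinct edges of `G₁`, the two
added edges are distinct and not already present (no multiedge and no doubled
self-loop is created). -/
def DoubleEdgeSwap (G₁ G₂ : LoopyGraph V) : Prop :=
  ∃ u v x y : V,
    G₁.Adj u v ∧ G₁.Adj x y ∧
    s(u, v) ≠ s(x, y) ∧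
    ¬ G₁.Adj u x ∧ ¬ G₁.Adj v y ∧ s(u, x) ≠ s(v, y) ∧
    ∀ a b : V, G₂.Adj a b ↔
      ((G₁.Adj a b ∧ s(a, b) ≠ s(u, v) ∧ s(a, b) ≠ s(x, y)) ∨
        s(a, b) = s(u, x) ∨ s(a, b) = s(v, y))

/-- `G₂` is reachable from `G₁` by a finite sequence of valid double edge swaps. -/
def Reach (G₁ G₂ : LoopyGraph V) : Prop :=
  Relation.ReflTransGen DoubleEdgeSwap G₁ G₂

/-- Vertices at (shortest-path) distance at most `k` from the set of loop-free vertices. -/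
def within (G : LoopyGraph V) : ℕ → Set V
  | 0 => {v | ¬ G.Adj v v}
  | (k + 1) => within G k ∪ {v | ∃ u ∈ within G k, G.Adj v u}

/-- `Vset G 0 = V^0` is the set of vertices with no self-loop; for `k ≥ 1`,
`Vset G k = V^k` is the set of vertices (necessarily carrying a self-loop) whose
shortest-path distance to `V^0` is exactly `k`. -/
def Vset (G : LoopyGraph V) : ℕ → Set V
  | 0 => {v | ¬ G.Adj v v}
  | (k + 1) => within G (k + 1) \ within G k

/-- `V^∞`: vertices (with a self-loop) having no path to `V^0`. -/
def Vinf (G : LoopyGraph V) : Set V := {v | ∀ k : ℕ, v ∉ within G k}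

/-- A set of vertices is a clique when all pairs of distinct members are adjacent. -/
def IsClique (G : LoopyGraph V) (s : Set V) : Prop :=
  ∀ x ∈ s, ∀ y ∈ s, x ≠ y → G.Adj x y

/-- The set of vertices carrying a self-loop. -/
def selfLoops (G : LoopyGraph V) : Set V := {v | G.Adj v v}

/-- The edges of `G` with both endpoints in `V^0`. -/
def V0edges (G : LoopyGraph V) : Set (Sym2 V) :=
  {e | ∃ u v : V, e = s(u, v) ∧ G.Adj u v ∧ u ∈ Vset G 0 ∧ v ∈ Vset G 0}

/-- `Ĝ` is swap-maximal: among all loopy graphs reachable from it by double edge swaps it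
has the maximum number of self-loops, and subject to that the maximum number of edges with
both endpoints in `V^0`. -/
def SwapMaximal (G : LoopyGraph V) : Prop :=
  ∀ H : LoopyGraph V, Reach G H →
    (selfLoops H).ncard ≤ (selfLoops G).ncard ∧
      ((selfLoops H).ncard = (selfLoops G).ncard →
        (V0edges H).ncard ≤ (V0edges G).ncard)

/-- `K` is a largest clique contained in `V^0`, and it has exactly `d` vertices. -/
def LargestV0Clique (G : LoopyGraph V) (K : Set V) (d : ℕ) : Prop :=
  K ⊆ Vset G 0 ∧ IsClique G K ∧ K.ncard = d ∧
    ∀ K' : Set V, K' ⊆ Vset G 0 → IsClique G K' → K'.ncard ≤ d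

/-- Class `Q1`. -/
def Q1 (G : LoopyGraph V) : Prop :=
  ∃ K : Set V, K ⊆ Vset G 0 ∧ 4 ≤ K.ncard ∧ IsClique G K ∧
    (∀ u ∈ Vset G 0, (∀ w ∈ Vset G 0, ¬ G.Adj u w) ∨ u ∈ K) ∧
    IsClique G (Vset G 1 ∪ K) ∧
    Vset G 2 = ∅ ∧ Vinf G = ∅

/-- Class `Q2`. -/
def Q2 (G : LoopyGraph V) : Prop :=
  3 ≤ {u | u ∈ Vset G 0 ∧ (nbr G u ∩ Vset G 0).ncard = 2}.ncard ∧
  (∀ u ∈ Vset G 0,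
      (∀ w ∈ Vset G 0, ¬ G.Adj u w) ∨
        ((nbr G u ∩ Vset G 0).ncard = 2 ∧ ∀ w ∈ Vset G 1, G.Adj u w)) ∧
  IsClique G (Vset G 1) ∧
  (∀ u ∈ Vset G 2, nbr G u = Vset G 1) ∧
  Vset G 3 = ∅ ∧
  (Vinf G = ∅ ∨ (Vset G 1 = ∅ ∧ ∀ u ∈ Vinf G, deg G u = 2))

/-- The graph of loopy graphs `𝒢({k_i})` is connected: any two loopy graphs with degree
sequence `k` are linked by a finite sequence of valid double edge swaps. -/
def GConnected (k : V → ℕ) : Prop :=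
  ∀ G₁ G₂ : LoopyGraph V, (∀ v, deg G₁ v = k v) → (∀ v, deg G₂ v = k v) →
    Reach G₁ G₂

/-- `G₂` is obtained from `G₁` by a single valid triangle-loop swap: either a triangle on
three distinct vertices is replaced by three self-loops, or conversely. -/
def TriangleLoopSwap (G₁ G₂ : LoopyGraph V) : Prop :=
  ∃ u v w : V, u ≠ v ∧ v ≠ w ∧ u ≠ w ∧
    ((G₁.Adj u v ∧ G₁.Adj v w ∧ G₁.Adj w u ∧
        ¬ G₁.Adj u u ∧ ¬ G₁.Adj v v ∧ ¬ G₁.Adj w w ∧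
        ∀ a b : V, G₂.Adj a b ↔
          ((G₁.Adj a b ∧ s(a, b) ≠ s(u, v) ∧ s(a, b) ≠ s(v, w) ∧ s(a, b) ≠ s(w, u)) ∨
            s(a, b) = s(u, u) ∨ s(a, b) = s(v, v) ∨ s(a, b) = s(w, w))) ∨
      (G₁.Adj u u ∧ G₁.Adj v v ∧ G₁.Adj w w ∧
        ¬ G₁.Adj u v ∧ ¬ G₁.Adj v w ∧ ¬ G₁.Adj w u ∧
        ∀ a b : V, G₂.Adj a b ↔
          ((G₁.Adj a b ∧ s(a, b) ≠ s(u, u) ∧ s(a, b) ≠ s(v, v) ∧ s(a, b) ≠ s(w, w)) ∨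
            s(a, b) = s(u, v) ∨ s(a, b) = s(v, w) ∨ s(a, b) = s(w, u))))

/-- Reachability in the augmented graph of loopy graphs `𝒢_△`: a finite sequence of moves,
each a valid double edge swap or a valid triangle-loop swap. -/
def ReachTri (G₁ G₂ : LoopyGraph V) : Prop :=
  Relation.ReflTransGen
    (fun H₁ H₂ => DoubleEdgeSwap H₁ H₂ ∨ TriangleLoopSwap H₁ H₂) G₁ G₂

/-- `S` is a set of highest-degree vertices for the degree sequence `k`. -/
def TopSet (k : V → ℕ) (S : Set V) : Prop :=
  ∀ u ∈ S, ∀ v : V, v ∉ S → k v ≤ k u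

/-- A loopy graph is simple when it has no self-loops. -/
def IsSimple (G : LoopyGraph V) : Prop := ∀ v : V, ¬ G.Adj v v

/-- `k` is the degree sequence of some simple graph. -/
def SimpleGraphical (k : V → ℕ) : Prop :=
  ∃ G : LoopyGraph V, IsSimple G ∧ ∀ v, deg G v = k v

/-- `k` is `m`-simple-graphical: subtracting `2` from each of the `m` largest entries
yields a simple-graphical sequence. -/
def MSimpleGraphical (k : V → ℕ) (m : ℕ) : Prop :=
  ∃ S : Set V, S.ncard = m ∧ TopSet k S ∧ (∀ v ∈ S, 2 ≤ k v) ∧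
    SimpleGraphical (fun v : V => if v ∈ S then k v - 2 else k v)

/-- `m` is `m*`, the maximum `m` for which the sequence is `m`-simple-graphical. -/
def IsMStar (k : V → ℕ) (m : ℕ) : Prop :=
  MSimpleGraphical k m ∧ ∀ m' : ℕ, MSimpleGraphical k m' → m' ≤ m

/-- `G` is `m`-loopy: it has self-loops exactly at `m` highest-degree vertices. -/
def MLoopy (G : LoopyGraph V) (m : ℕ) : Prop :=
  (selfLoops G).ncard = m ∧ TopSet (deg G) (selfLoops G)

end LoopyGraph

namespace LoopyGraph

variable {V : Type}

theorem adj_comm (G : LoopyGraph V) (u v : V) : G.Adj u v ↔ G.Adj v u :=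
  ⟨G.symm u v, G.symm v u⟩

theorem adj_congr (G : LoopyGraph V) {a b u v : V} (h : s(a, b) = s(u, v)) :
    G.Adj a b ↔ G.Adj u v := by
  rcases Sym2.eq_iff.1 h with ⟨rfl, rfl⟩ | ⟨rfl, rfl⟩
  · rfl
  · exact G.adj_comm _ _

@[ext]
theorem ext {G H : LoopyGraph V} (h : ∀ a b, G.Adj a b ↔ H.Adj a b) : G = H := by
  cases G
  cases H
  congr
  funext a b
  exact propext (h a b)

theorem DoubleEdgeSwap.symm {G H : LoopyGraph V} (h : DoubleEdgeSwap G H) :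
    DoubleEdgeSwap H G := by
  obtain ⟨u, v, x, y, huv, hxy, hne, hux, hvy, hne', hH⟩ := h
  have key : ∀ a b p q, s(a, b) = s(p, q) → (G.Adj a b ↔ G.Adj p q) :=
    fun _ _ _ _ h => G.adj_congr h
  refine ⟨u, x, v, y, ?_, ?_, hne', ?_, ?_, hne, fun a b => ?_⟩
  · simp [hH]
  · simp [hH]
  · have := key u v u x
    have := key u v v y
    grind
  · have := key x y u x
    have := key x y v y
    grind
  · have := key a b u v
    have := key a b x y
    have := key a b u x
    have := key a b v y
    grind

theorem TriangleLoopSwap.symm {G H : LoopyGraph V} (h : TriangleLoopSwap G H) :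
    TriangleLoopSwap H G := by
  obtain ⟨u, v, w, huv, hvw, huw, ⟨h1, h2, h3, h4, h5, h6, hH⟩ | ⟨h1, h2, h3, h4, h5, h6, hH⟩⟩ := h
  all_goals
    have key : ∀ a b p q, s(a, b) = s(p, q) → (G.Adj a b ↔ G.Adj p q) :=
      fun _ _ _ _ h => G.adj_congr h
  · refine ⟨u, v, w, huv, hvw, huw, Or.inr ⟨?_, ?_, ?_, ?_, ?_, ?_, fun a b => ?_⟩⟩
    any_goals simp only [hH, Sym2.eq_iff]; grind
    have := key a b u v
    have := key a b v w
    have := key a b w u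
    have := key a b u u
    have := key a b v v
    have := key a b w w
    grind
  · refine ⟨u, v, w, huv, hvw, huw, Or.inl ⟨?_, ?_, ?_, ?_, ?_, ?_, fun a b => ?_⟩⟩
    any_goals simp only [hH, Sym2.eq_iff]; grind
    have := key a b u v
    have := key a b v w
    have := key a b w u
    have := key a b u u
    have := key a b v v
    have := key a b w w
    grind

theorem ReachTri.symm {G H : LoopyGraph V} (h : ReachTri G H) : ReachTri H G := by
  induction h with
  | refl => exact .refl
  | tail _ h ih => exact .head (h.imp DoubleEdgeSwap.symm TriangleLoopSwap.symm) ih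

/-- The degree of `u` inside the vertex set `S`, for `u ∈ S`. -/
noncomputable def degIn (G : LoopyGraph V) (S : Finset V) (u : V) : ℕ :=
  (S.filter (G.Adj u)).card + if G.Adj u u then 1 else 0

theorem degIn_univ [Fintype V] (G : LoopyGraph V) (u : V) :
    G.degIn Finset.univ u = G.deg u := by
  have h : G.nbr u = ↑((Finset.univ.filter (G.Adj u)).erase u) := by
    ext w
    simp [nbr, and_comm]
  rw [deg, h, Set.ncard_coe_finset, degIn]
  by_cases hu : G.Adj u u
  · have hmem : u ∈ Finset.univ.filter (G.Adj u) := by simp [hu]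
    have := Finset.card_erase_add_one hmem
    simp only [hu, if_true]
    omega
  · rw [Finset.erase_eq_of_notMem (by simp [hu])]
    simp [hu]

/-- `H` is reached from `G` by moves, agrees with it on all pairs not contained in `S`, and has
the same degrees inside `S`. -/
structure ReachIn (S : Finset V) (G H : LoopyGraph V) : Prop where
  reach : ReachTri G H
  agree : ∀ a b, ¬ (a ∈ S ∧ b ∈ S) → (G.Adj a b ↔ H.Adj a b)
  degIn_eq : ∀ a, G.degIn S a = H.degIn S a

theorem ReachIn.refl (S : Finset V) (G : LoopyGraph V) : ReachIn S G G :=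
  ⟨.refl, fun _ _ _ => Iff.rfl, fun _ => rfl⟩

theorem ReachIn.trans {S : Finset V} {G H K : LoopyGraph V} (h : ReachIn S G H)
    (h' : ReachIn S H K) : ReachIn S G K :=
  ⟨h.reach.trans h'.reach, fun a b hab => (h.agree a b hab).trans (h'.agree a b hab),
    fun a => (h.degIn_eq a).trans (h'.degIn_eq a)⟩

theorem degIn_eq_sum (G : LoopyGraph V) (S : Finset V) (a : V) :
    G.degIn S a = ∑ b ∈ S, (if G.Adj a b then 1 else 0) + if G.Adj a a then 1 else 0 := by
  rw [degIn, Finset.card_filter]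

/-- An edge of `S` contributes to the degree of its endpoints only, a loop counting twice. -/
theorem sum_incidence {S : Finset V} {p q : V} (hp : p ∈ S) (hq : q ∈ S) (a : V) :
    ∑ b ∈ S, (if s(a, b) = s(p, q) then 1 else 0) + (if s(a, a) = s(p, q) then 1 else 0) =
      (if a = p then 1 else 0) + (if a = q then 1 else 0) := by
  by_cases hap : a = p
  · subst hap
    by_cases haq : a = q
    · subst haq
      simp [hp]
    · simp [haq, hq]
  · by_cases haq : a = q
    · subst haq
      simp [hap, hp]
    · simp [hap, haq]

theorem exists_doubleEdgeSwap {S : Finset V} (G : LoopyGraph V) {u v x y : V}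
    (hu : u ∈ S) (hv : v ∈ S) (hx : x ∈ S) (hy : y ∈ S)
    (huv : G.Adj u v) (hxy : G.Adj x y) (hne : s(u, v) ≠ s(x, y))
    (hux : ¬ G.Adj u x) (hvy : ¬ G.Adj v y) (hne' : s(u, x) ≠ s(v, y)) :
    ∃ H, ReachIn S G H ∧ ∀ a b, H.Adj a b ↔
      ((G.Adj a b ∧ s(a, b) ≠ s(u, v) ∧ s(a, b) ≠ s(x, y)) ∨
        s(a, b) = s(u, x) ∨ s(a, b) = s(v, y)) := by
  let H : LoopyGraph V :=
    { Adj := fun a b => (G.Adj a b ∧ s(a, b) ≠ s(u, v) ∧ s(a, b) ≠ s(x, y)) ∨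
        s(a, b) = s(u, x) ∨ s(a, b) = s(v, y)
      symm := fun a b h => by rwa [G.adj_comm, Sym2.eq_swap] }
  have hH : ∀ a b, H.Adj a b ↔ ((G.Adj a b ∧ s(a, b) ≠ s(u, v) ∧ s(a, b) ≠ s(x, y)) ∨
        s(a, b) = s(u, x) ∨ s(a, b) = s(v, y)) := fun _ _ => Iff.rfl
  clear_value H
  refine ⟨H, ⟨.single (.inl ⟨u, v, x, y, huv, hxy, hne, hux, hvy, hne', hH⟩),
    fun a b hab => ?_, fun a => ?_⟩, hH⟩
  · have h : ∀ p ∈ S, ∀ q ∈ S, s(a, b) ≠ s(p, q) := by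
      intro p hp q hq h
      rcases Sym2.eq_iff.1 h with ⟨rfl, rfl⟩ | ⟨rfl, rfl⟩
      · exact hab ⟨hp, hq⟩
      · exact hab ⟨hq, hp⟩
    simp [hH, h u hu v hv, h x hx y hy, h u hu x hx, h v hv y hy]
  · have hpt : ∀ b, (if H.Adj a b then 1 else 0) + (if s(a, b) = s(u, v) then 1 else 0)
        + (if s(a, b) = s(x, y) then 1 else 0) = (if G.Adj a b then 1 else 0)
        + (if s(a, b) = s(u, x) then 1 else 0) + (if s(a, b) = s(v, y) then 1 else 0) := by
      intro b
      have h1 := G.adj_congr (a := a) (b := b) (u := u) (v := v)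
      have h2 := G.adj_congr (a := a) (b := b) (u := x) (v := y)
      have h3 := G.adj_congr (a := a) (b := b) (u := u) (v := x)
      have h4 := G.adj_congr (a := a) (b := b) (u := v) (v := y)
      have h5 := hH a b
      grind
    have hsum := Finset.sum_congr (rfl : S = S) fun b _ => hpt b
    simp only [Finset.sum_add_distrib] at hsum
    have hdiag := hpt a
    have h1 := sum_incidence hu hv a
    have h2 := sum_incidence hx hy a
    have h3 := sum_incidence hu hx a
    have h4 := sum_incidence hv hy a
    rw [degIn_eq_sum, degIn_eq_sum]
    omega

theorem exists_triangleLoopSwap {S : Finset V} (G : LoopyGraph V) {u v w : V}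
    (hu : u ∈ S) (hv : v ∈ S) (hw : w ∈ S) (huv : u ≠ v) (hvw : v ≠ w) (huw : u ≠ w)
    (auv : G.Adj u v) (avw : G.Adj v w) (awu : G.Adj w u)
    (auu : ¬ G.Adj u u) (avv : ¬ G.Adj v v) (aww : ¬ G.Adj w w) :
    ∃ H, ReachIn S G H ∧ H.Adj u u := by
  let H : LoopyGraph V :=
    { Adj := fun a b =>
        (G.Adj a b ∧ s(a, b) ≠ s(u, v) ∧ s(a, b) ≠ s(v, w) ∧ s(a, b) ≠ s(w, u)) ∨
          s(a, b) = s(u, u) ∨ s(a, b) = s(v, v) ∨ s(a, b) = s(w, w)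
      symm := fun a b h => by rwa [G.adj_comm, Sym2.eq_swap] }
  have hH : ∀ a b, H.Adj a b ↔
      ((G.Adj a b ∧ s(a, b) ≠ s(u, v) ∧ s(a, b) ≠ s(v, w) ∧ s(a, b) ≠ s(w, u)) ∨
          s(a, b) = s(u, u) ∨ s(a, b) = s(v, v) ∨ s(a, b) = s(w, w)) := fun _ _ => Iff.rfl
  clear_value H
  refine ⟨H, ⟨.single (.inr ⟨u, v, w, huv, hvw, huw,
    .inl ⟨auv, avw, awu, auu, avv, aww, hH⟩⟩), fun a b hab => ?_, fun a => ?_⟩, by simp [hH]⟩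
  · have h : ∀ p ∈ S, ∀ q ∈ S, s(a, b) ≠ s(p, q) := by
      intro p hp q hq h
      rcases Sym2.eq_iff.1 h with ⟨rfl, rfl⟩ | ⟨rfl, rfl⟩
      · exact hab ⟨hp, hq⟩
      · exact hab ⟨hq, hp⟩
    rw [hH]
    simp only [h u hu v hv, h v hv w hw, h w hw u hu, h u hu u hu, h v hv v hv, h w hw w hw,
      ne_eq, not_false_eq_true, and_true, or_false]
  · have hpt : ∀ b, (if H.Adj a b then 1 else 0) + (if s(a, b) = s(u, v) then 1 else 0)
        + (if s(a, b) = s(v, w) then 1 else 0) + (if s(a, b) = s(w, u) then 1 else 0)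
        = (if G.Adj a b then 1 else 0) + (if s(a, b) = s(u, u) then 1 else 0)
        + (if s(a, b) = s(v, v) then 1 else 0) + (if s(a, b) = s(w, w) then 1 else 0) := by
      intro b
      have h1 := G.adj_congr (a := a) (b := b) (u := u) (v := v)
      have h2 := G.adj_congr (a := a) (b := b) (u := v) (v := w)
      have h3 := G.adj_congr (a := a) (b := b) (u := w) (v := u)
      have h4 := G.adj_congr (a := a) (b := b) (u := u) (v := u)
      have h5 := G.adj_congr (a := a) (b := b) (u := v) (v := v)
      have h6 := G.adj_congr (a := a) (b := b) (u := w) (v := w)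
      have h7 := hH a b
      have n1 : s(u, v) ≠ s(v, w) := by simp [huv, huw]
      have n2 : s(v, w) ≠ s(w, u) := by simp [hvw, huv.symm]
      have n3 : s(u, v) ≠ s(w, u) := by simp [huw, hvw]
      have n4 : s(u, u) ≠ s(v, v) := by simp [huv]
      have n5 : s(v, v) ≠ s(w, w) := by simp [hvw]
      have n6 : s(u, u) ≠ s(w, w) := by simp [huw]
      grind
    have hsum := Finset.sum_congr (rfl : S = S) fun b _ => hpt b
    simp only [Finset.sum_add_distrib] at hsum
    have hdiag := hpt a
    have h1 := sum_incidence hu hv a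
    have h2 := sum_incidence hv hw a
    have h3 := sum_incidence hw hu a
    have h4 := sum_incidence hu hu a
    have h5 := sum_incidence hv hv a
    have h6 := sum_incidence hw hw a
    rw [degIn_eq_sum, degIn_eq_sum]
    omega

/-- A vertex of maximum degree at least `2` can be given a self-loop. -/
theorem exists_reachIn_loop {S : Finset V} (G : LoopyGraph V) {v : V} (hv : v ∈ S)
    (hmax : ∀ u ∈ S, G.degIn S u ≤ G.degIn S v) (h2 : 2 ≤ G.degIn S v) :
    ∃ H, ReachIn S G H ∧ H.Adj v v := by
  by_cases hvv : G.Adj v v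
  · exact ⟨G, .refl S G, hvv⟩
  have hdeg : G.degIn S v = (S.filter (G.Adj v)).card := by simp [degIn, hvv]
  by_cases hcl : ∀ a ∈ S.filter (G.Adj v), ∀ b ∈ S.filter (G.Adj v), a ≠ b → G.Adj a b
  · have hloop : ∀ a ∈ S.filter (G.Adj v), ¬ G.Adj a a := by
      intro a ha haa
      have hsub : insert v (S.filter (G.Adj v)) ⊆ S.filter (G.Adj a) := by
        intro w hw
        have ha' := Finset.mem_filter.1 ha
        rcases Finset.mem_insert.1 hw with rfl | hw
        · exact Finset.mem_filter.2 ⟨hv, G.symm _ _ ha'.2⟩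
        · refine Finset.mem_filter.2 ⟨(Finset.mem_filter.1 hw).1, ?_⟩
          by_cases haw : a = w
          · exact haw ▸ haa
          · exact hcl a ha w hw haw
      have hcard := Finset.card_le_card hsub
      rw [Finset.card_insert_of_notMem (by simp [hvv])] at hcard
      have hle := hmax a (Finset.mem_filter.1 ha).1
      have : G.degIn S a = (S.filter (G.Adj a)).card + 1 := by simp [degIn, haa]
      omega
    obtain ⟨a, ha, b, hb, hab⟩ := Finset.one_lt_card.1 (by omega : 1 < (S.filter (G.Adj v)).card)
    have ha' := Finset.mem_filter.1 ha
    have hb' := Finset.mem_filter.1 hb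
    refine G.exists_triangleLoopSwap hv ha'.1 hb'.1 ?_ hab ?_ ha'.2 (hcl a ha b hb hab)
      (G.symm _ _ hb'.2) hvv (hloop a ha) (hloop b hb)
    · rintro rfl
      exact hvv ha'.2
    · rintro rfl
      exact hvv hb'.2
  · push Not at hcl
    obtain ⟨a, ha, b, hb, hab, hnab⟩ := hcl
    have ha' := Finset.mem_filter.1 ha
    have hb' := Finset.mem_filter.1 hb
    have hav : v ≠ a := by
      rintro rfl
      exact hvv ha'.2
    obtain ⟨H, hGH, hH⟩ := G.exists_doubleEdgeSwap hv ha'.1 hv hb'.1 ha'.2 hb'.2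
      (by simp only [ne_eq, Sym2.eq_iff]; grind) hvv hnab
      (by simp only [ne_eq, Sym2.eq_iff]; grind)
    exact ⟨H, hGH, by simp [hH]⟩

/-- A neighbor `b` of `v` can be exchanged for a non-neighbor `a` of at least the same degree. -/
theorem exists_reachIn_exchange {S : Finset V} (G : LoopyGraph V) {v a b : V} (hv : v ∈ S)
    (ha : a ∈ S) (hb : b ∈ S) (hav : a ≠ v) (hbv : b ≠ v) (hvb : G.Adj v b)
    (hva : ¬ G.Adj v a) (hdeg : G.degIn S b ≤ G.degIn S a) :
    ∃ H, ReachIn S G H ∧ ∀ w, H.Adj v w ↔ (G.Adj v w ∧ w ≠ b) ∨ w = a := by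
  obtain ⟨c, hc, hac, hbc⟩ : ∃ c ∈ S, G.Adj a c ∧ ¬ G.Adj b c := by
    by_contra! hcon
    have hsub : insert v (S.filter (G.Adj a)) ⊆ S.filter (G.Adj b) := by
      intro w hw
      rcases Finset.mem_insert.1 hw with rfl | hw
      · exact Finset.mem_filter.2 ⟨hv, G.symm _ _ hvb⟩
      · have hw' := Finset.mem_filter.1 hw
        exact Finset.mem_filter.2 ⟨hw'.1, hcon w hw'.1 hw'.2⟩
    have hcard := Finset.card_le_card hsub
    rw [Finset.card_insert_of_notMem (by simp [G.adj_comm a v, hva])] at hcard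
    have hloop : G.Adj a a → G.Adj b b := fun haa =>
      hcon b hb (G.symm _ _ (hcon a ha haa))
    unfold degIn at hdeg
    grind
  have hcv : c ≠ v := by
    rintro rfl
    exact hva (G.symm _ _ hac)
  have hab : a ≠ b := by
    rintro rfl
    exact hva hvb
  obtain ⟨H, hGH, hH⟩ := G.exists_doubleEdgeSwap hv hb ha hc hvb hac
    (by simp [hav.symm, hcv.symm]) hva hbc
    (by simp [hbv.symm, hcv.symm])
  refine ⟨H, hGH, fun w => ?_⟩
  rw [hH]
  simp only [Sym2.eq_iff]
  grind

/-- Two graphs with the same degrees that agree on the self-loop at `v` and outside `S` can be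
moved to graphs with the same neighbors of `v`. -/
theorem exists_reachIn_adj_iff {S : Finset V} {v : V} (hv : v ∈ S) (n : ℕ) :
    ∀ G H : LoopyGraph V, (S.filter fun w => G.Adj v w ∧ ¬ H.Adj v w).card = n →
      (∀ a ∈ S, G.degIn S a = H.degIn S a) →
      (∀ a b, ¬ (a ∈ S ∧ b ∈ S) → (G.Adj a b ↔ H.Adj a b)) → (G.Adj v v ↔ H.Adj v v) →
      ∃ G' H', ReachIn S G G' ∧ ReachIn S H H' ∧ ∀ w, G'.Adj v w ↔ H'.Adj v w := by
  induction n with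
  | zero =>
    intro G H hn hdeg hagree hloop
    have hsub : S.filter (G.Adj v) ⊆ S.filter (H.Adj v) := by
      intro w hw
      have hw' := Finset.mem_filter.1 hw
      refine Finset.mem_filter.2 ⟨hw'.1, ?_⟩
      by_contra hcon
      have := Finset.filter_eq_empty_iff.1 (Finset.card_eq_zero.1 hn) hw'.1
      exact this ⟨hw'.2, hcon⟩
    have hcard := hdeg v hv
    simp only [degIn, hloop] at hcard
    have heq := Finset.eq_of_subset_of_card_le hsub (by omega)
    refine ⟨G, H, .refl S G, .refl S H, fun w => ?_⟩
    by_cases hw : w ∈ S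
    · have := congrArg (w ∈ ·) heq
      simpa [hw] using this
    · exact hagree v w fun h => hw h.2
  | succ n ih =>
    intro G H hn hdeg hagree hloop
    have hcard := hdeg v hv
    simp only [degIn, hloop] at hcard
    have hsplit : ∀ K L : LoopyGraph V, (S.filter fun w => K.Adj v w ∧ ¬ L.Adj v w)
        = S.filter (K.Adj v) \ S.filter (L.Adj v) := by
      intro K L
      ext w
      simp only [Finset.mem_filter, Finset.mem_sdiff]
      tauto
    have hsymm : (S.filter (G.Adj v) \ S.filter (H.Adj v)).card
        = (S.filter (H.Adj v) \ S.filter (G.Adj v)).card :=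
      Finset.card_sdiff_comm (by omega)
    rw [← hsplit, ← hsplit] at hsymm
    obtain ⟨b, hb⟩ := Finset.card_pos.1 (by omega :
      0 < (S.filter fun w => G.Adj v w ∧ ¬ H.Adj v w).card)
    obtain ⟨a, ha⟩ := Finset.card_pos.1 (by omega :
      0 < (S.filter fun w => H.Adj v w ∧ ¬ G.Adj v w).card)
    have hb' := Finset.mem_filter.1 hb
    have ha' := Finset.mem_filter.1 ha
    have hbv : b ≠ v := by
      rintro rfl
      exact hb'.2.2 (hloop.1 hb'.2.1)
    have hav : a ≠ v := by
      rintro rfl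
      exact ha'.2.2 (hloop.2 ha'.2.1)
    have hcount := Finset.card_erase_of_mem hb
    rcases le_total (G.degIn S b) (G.degIn S a) with hle | hle
    · obtain ⟨K, hGK, hK⟩ := G.exists_reachIn_exchange hv ha'.1 hb'.1 hav hbv hb'.2.1 ha'.2.2 hle
      obtain ⟨G', H', hG', hH', h⟩ := ih K H
        (by
          have : (S.filter fun w => K.Adj v w ∧ ¬ H.Adj v w)
              = (S.filter fun w => G.Adj v w ∧ ¬ H.Adj v w).erase b := by
            ext w
            simp only [Finset.mem_filter, Finset.mem_erase, hK]
            grind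
          rw [this]
          omega)
        (fun x hx => (hGK.degIn_eq x).symm.trans (hdeg x hx))
        (fun x y hxy => (hGK.agree x y hxy).symm.trans (hagree x y hxy))
        (by rw [hK]; grind)
      exact ⟨G', H', hGK.trans hG', hH', h⟩
    · obtain ⟨K, hHK, hK⟩ := H.exists_reachIn_exchange hv hb'.1 ha'.1 hbv hav ha'.2.1 hb'.2.2
        (by rwa [← hdeg a ha'.1, ← hdeg b hb'.1])
      obtain ⟨G', H', hG', hH', h⟩ := ih G K
        (by
          have : (S.filter fun w => G.Adj v w ∧ ¬ K.Adj v w)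
              = (S.filter fun w => G.Adj v w ∧ ¬ H.Adj v w).erase b := by
            ext w
            simp only [Finset.mem_filter, Finset.mem_erase, hK]
            grind
          rw [this]
          omega)
        (fun x hx => (hdeg x hx).trans (hHK.degIn_eq x))
        (fun x y hxy => (hagree x y hxy).trans (hHK.agree x y hxy))
        (by rw [hK]; grind)
      exact ⟨G', H', hG', hHK.trans hH', h⟩

theorem degIn_eq_degIn_erase_add {S : Finset V} (G : LoopyGraph V) {v : V} (hv : v ∈ S) (u : V) :
    G.degIn S u = G.degIn (S.erase v) u + if G.Adj u v then 1 else 0 := by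
  rw [degIn_eq_sum, degIn_eq_sum, ← Finset.sum_erase_add S _ hv]
  omega

theorem reachTri_of_agree (S : Finset V) : ∀ G H : LoopyGraph V,
    (∀ a ∈ S, G.degIn S a = H.degIn S a) →
    (∀ a b, ¬ (a ∈ S ∧ b ∈ S) → (G.Adj a b ↔ H.Adj a b)) → ReachTri G H := by
  induction S using Finset.strongInduction with
  | H S ih =>
  intro G H hdeg hagree
  rcases S.eq_empty_or_nonempty with rfl | hne
  · have : G = H := by
      ext a b
      exact hagree a b (by simp)
    exact this ▸ .refl
  obtain ⟨v, hv, hmax⟩ := Finset.exists_max_image S (G.degIn S) hne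
  obtain ⟨G₁, H₁, hG₁, hH₁, hloop⟩ : ∃ G₁ H₁, ReachIn S G G₁ ∧ ReachIn S H H₁ ∧
      (G₁.Adj v v ↔ H₁.Adj v v) := by
    by_cases h2 : 2 ≤ G.degIn S v
    · obtain ⟨G₁, hG₁, hGv⟩ := G.exists_reachIn_loop hv hmax h2
      obtain ⟨H₁, hH₁, hHv⟩ := H.exists_reachIn_loop hv
        (fun u hu => by rw [← hdeg u hu, ← hdeg v hv]; exact hmax u hu) (hdeg v hv ▸ h2)
      exact ⟨G₁, H₁, hG₁, hH₁, iff_of_true hGv hHv⟩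
    · have hno : ∀ K : LoopyGraph V, ¬ 2 ≤ K.degIn S v → ¬ K.Adj v v := by
        intro K hK hvv
        have : 0 < (S.filter (K.Adj v)).card :=
          Finset.card_pos.2 ⟨v, Finset.mem_filter.2 ⟨hv, hvv⟩⟩
        simp only [degIn, hvv, if_true] at hK
        omega
      exact ⟨G, H, .refl S G, .refl S H, iff_of_false (hno G h2) (hno H (hdeg v hv ▸ h2))⟩
  obtain ⟨G₂, H₂, hG₂, hH₂, hadj⟩ := exists_reachIn_adj_iff hv _ G₁ H₁ rfl
    (fun a ha => by rw [← hG₁.degIn_eq, ← hH₁.degIn_eq, hdeg a ha])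
    (fun a b hab => by rw [← hG₁.agree a b hab, ← hH₁.agree a b hab, hagree a b hab]) hloop
  have hG := hG₁.trans hG₂
  have hH := hH₁.trans hH₂
  have hmid : ReachTri G₂ H₂ := by
    refine ih (S.erase v) (Finset.erase_ssubset hv) G₂ H₂ (fun a ha => ?_) (fun a b hab => ?_)
    · have h1 := G₂.degIn_eq_degIn_erase_add hv a
      have h2 := H₂.degIn_eq_degIn_erase_add hv a
      rw [← hG.degIn_eq, hdeg a (Finset.mem_of_mem_erase ha), G₂.adj_comm, hadj] at h1
      rw [← hH.degIn_eq, H₂.adj_comm] at h2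
      omega
    · by_cases hS : a ∈ S ∧ b ∈ S
      · by_cases hav : a = v
        · exact hav ▸ hadj b
        · have hbv : b = v := by
            by_contra hbv
            exact hab ⟨Finset.mem_erase.2 ⟨hav, hS.1⟩, Finset.mem_erase.2 ⟨hbv, hS.2⟩⟩
          rw [hbv, G₂.adj_comm, H₂.adj_comm]
          exact hadj a
      · rw [← hG.agree a b hS, ← hH.agree a b hS, hagree a b hS]
  exact hG.reach.trans (hmid.trans hH.reach.symm)

end LoopyGraph

/-- For every degree sequence, the augmented graph of loopy graphs `𝒢_△(k)`
is connected: any two loopy graphs with degree sequence `k` are linked by a finite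
sequence of valid double edge swaps and valid triangle-loop swaps. -/
theorem triangle_swap_connected {V : Type} [Fintype V] (k : V → ℕ)
    (G₁ G₂ : LoopyGraph V) (h₁ : ∀ v, G₁.deg v = k v) (h₂ : ∀ v, G₂.deg v = k v) :
    LoopyGraph.ReachTri G₁ G₂ :=
  LoopyGraph.reachTri_of_agree Finset.univ G₁ G₂
    (fun a _ => by rw [LoopyGraph.degIn_univ, LoopyGraph.degIn_univ, h₁, h₂])
    (fun a b h => absurd ⟨Finset.mem_univ a, Finset.mem_univ b⟩ h)
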